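/- arXiv:math/0501420 — 4 statements merged into one kernel-verified Lean document; each statement's English description precedes it below -/
import Mathlib

section
/- Let 𝒟 = {δ(w) : w an infinite word on the alphabet ℕ} ⊆ [1,+∞] and 𝒟₀ = {δ(w) : w an infinite word on ℕ with abundant palindromic prefixes}. Then 𝒟₀ ⊆ [1,2], and 𝒟 = 𝒟₀ ∪ (2,+∞]; in particular this union is disjoint. -/
open Filter
open scoped Classical

/-- The prefix of length `n` of the infinite word `w`. -/
def pref {A : Type*} (w : ℕ → A) (n : ℕ) : List A := (List.range n).map w

/-- The predicate "the prefix of `w` of length `n` is a palindrome". -/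
def palP {A : Type*} (w : ℕ → A) : ℕ → Prop := fun n => (pref w n).Palindrome

/-- `δ(w)`: the limsup of quotients of consecutive lengths of palindromic prefixes of `w`,
or `⊤` if `w` has only finitely many palindromic prefixes. -/
noncomputable def delta {A : Type*} (w : ℕ → A) : ENNReal :=
  if (setOf (palP w)).Infinite then
    limsup (fun i => (Nat.nth (palP w) (i + 1) : ENNReal) / (Nat.nth (palP w) i : ENNReal)) atTop
  else ⊤

/-- `w` has abundant palindromic prefixes. -/
def Abundant {A : Type*} (w : ℕ → A) : Prop :=
  (setOf (palP w)).Infinite ∧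
    ∀ i, Nat.nth (palP w) (i + 1) ≤ 2 * Nat.nth (palP w) i + 1

lemma palP_iff {A : Type*} (w : ℕ → A) (n : ℕ) :
    palP w n ↔ ∀ m, m < n → w (n - 1 - m) = w m := by
  unfold palP pref
  rw [List.Palindrome.iff_reverse_eq]
  constructor
  · intro h m hm
    have := congrArg (fun l => l[m]?) h
    simpa [hm] using this
  · intro h
    apply List.ext_getElem
    · simp
    · intro m h1 h2
      simp at h1 h2
      simp [h m h1]

lemma palP_zero {A : Type*} (w : ℕ → A) : palP w 0 := by
  rw [palP_iff]; intro m hm; omega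

lemma nth_eq {p : ℕ → Prop} {l : ℕ → ℕ} (hl : StrictMono l) (h : ∀ n, p n ↔ ∃ k, l k = n) :
    (setOf p).Infinite ∧ Nat.nth p = l := by
  have hs : Set.ofPred p = Set.range l := by
    ext n; simp [h]
  have hi : (Set.ofPred p).Infinite := by
    rw [hs]; exact Set.infinite_range_of_injective hl.injective
  refine ⟨hi, ?_⟩
  apply (StrictMono.range_inj (Nat.nth_strictMono hi) hl).1
  rw [Nat.range_nth_of_infinite hi, hs]

section constr

lemma exists_word (l : ℕ → ℕ) (h0 : l 0 = 0) (h1 : l 1 = 1)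
    (h2 : ∀ k, 2 * l k + 1 ≤ l (k + 1)) :
    ∃ w : ℕ → ℕ, ∀ n, palP w n ↔ ∃ k, l k = n := by
  have hm : StrictMono l := strictMono_nat_of_lt_succ (fun k => by have := h2 k; omega)
  have hex : ∀ m, ∃ k, m < l (k + 1) := fun m => ⟨m, lt_of_lt_of_le (Nat.lt_succ_self m) (hm.id_le (m+1))⟩
  let K : ℕ → ℕ := fun m => Nat.find (hex m)
  have hK1 : ∀ m, m < l (K m + 1) := fun m => Nat.find_spec (hex m)
  have hK2 : ∀ m, l (K m) ≤ m := by
    intro m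
    rcases hk : K m with _ | k
    · omega
    · by_contra hc
      push Not at hc
      have := Nat.find_min' (hex m) hc
      change K m ≤ k at this
      omega
  have hKu : ∀ m k, l k ≤ m → m < l (k+1) → K m = k := by
    intro m k ha hb
    have e1 : l k < l (K m + 1) := lt_of_le_of_lt ha (hK1 m)
    have e2 : l (K m) < l (k + 1) := lt_of_le_of_lt (hK2 m) hb
    rw [hm.lt_iff_lt] at e1 e2
    omega
  have hw : ∃ w : ℕ → ℕ, ∀ m, w m = if m < l (K m + 1) - l (K m) then K m
      else w (l (K m + 1) - 1 - m) := by
    let F : (m : ℕ) → ((y : ℕ) → y < m → ℕ) → ℕ := fun m ih =>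
      if h : m < l (K m + 1) - l (K m) then K m
      else ih (l (K m + 1) - 1 - m) (by have := hK1 m; have := hK2 m; omega)
    refine ⟨fun m => Nat.lt_wfRel.wf.fix F m, fun m => ?_⟩
    change Nat.lt_wfRel.wf.fix F m = _
    rw [WellFounded.fix_eq]
    simp only [F, dite_eq_ite]
  obtain ⟨w, hw⟩ := hw
  have hlt : ∀ m k, m < l k → w m < k := by
    intro m
    induction m using Nat.strong_induction_on with
    | _ m ih =>
      intro k hk
      have hKk : K m < k := by
        have := lt_of_le_of_lt (hK2 m) hk
        rwa [hm.lt_iff_lt] at this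
      rw [hw]
      have a1 := hK1 m
      have a2 := hK2 m
      split_ifs with hc
      · exact hKk
      · have := ih (l (K m + 1) - 1 - m) (by omega) (K m) (by omega)
        omega
  have hmid : ∀ m k, l k ≤ m → m < l (k+1) - l k → w m = k := by
    intro m k ha hb
    have e := hKu m k ha (by omega)
    rw [hw, e, if_pos hb]
  have hend : ∀ m k, l (k+1) - l k ≤ m → m < l (k+1) → w m = w (l (k+1) - 1 - m) := by
    intro m k ha hb
    have e := hKu m k (by have := h2 k; omega) hb
    rw [hw m, e, if_neg (by omega)]
  refine ⟨w, fun n => ⟨fun hp => ?_, ?_⟩⟩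
  · rw [palP_iff] at hp
    rcases Nat.eq_zero_or_pos n with rfl | hn
    · exact ⟨0, h0⟩
    set k := K (n - 1) with hk
    have a1 := hK1 (n - 1)
    have a2 := hK2 (n - 1)
    rw [← hk] at a1 a2
    have a3 := h2 k
    have e1 := hp (l k) (by omega)
    rw [hmid (l k) k le_rfl (by omega)] at e1
    rcases Nat.eq_zero_or_pos k with h | hkp
    · rw [h, zero_add, h1] at a1
      exact ⟨1, by omega⟩
    have hlk : l 0 < l k := hm hkp
    refine ⟨k + 1, ?_⟩
    by_contra hne
    by_cases hc : n ≤ l (k+1) - l k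
    · have e2 := hp 0 (by omega)
      rw [hmid (n - 1 - 0) k (by omega) (by omega)] at e2
      have := hlt 0 k (by omega)
      omega
    · have e2 := hp (n - 1 - (l (k+1) - l k - 1)) (by omega)
      rw [show n - 1 - (n - 1 - (l (k+1) - l k - 1)) = l (k+1) - l k - 1 by omega,
        hmid _ k (by omega) (by omega)] at e2
      have := hlt (n - 1 - (l (k+1) - l k - 1)) k (by omega)
      omega
  · rintro ⟨k, rfl⟩
    rw [palP_iff]
    intro m hmk
    rcases k with _ | k
    · omega
    have a3 := h2 k
    by_cases c1 : m < l k
    · rw [hend (l (k+1) - 1 - m) k (by omega) (by omega)]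
      congr 1; omega
    by_cases c2 : m < l (k+1) - l k
    · rw [hmid m k (by omega) c2, hmid _ k (by omega) (by omega)]
    · rw [hend m k (by omega) hmk]

end constr

lemma div_ofReal (a b : ℕ) (hb : 0 < b) : (a : ENNReal) / (b : ENNReal) = ENNReal.ofReal ((a : ℝ) / b) := by
  rw [ENNReal.ofReal_div_of_pos (by exact_mod_cast hb), ENNReal.ofReal_natCast, ENNReal.ofReal_natCast]

lemma delta_shift {A : Type*} (w : ℕ → A) (hi : (setOf (palP w)).Infinite) (N : ℕ) :
    delta w = limsup (fun i => (Nat.nth (palP w) (i + N + 1) : ENNReal) / (Nat.nth (palP w) (i + N) : ENNReal)) atTop := by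
  rw [delta, if_pos hi]
  exact (Filter.limsup_nat_add (fun i => (Nat.nth (palP w) (i + 1) : ENNReal) / (Nat.nth (palP w) i : ENNReal)) N).symm

/-- any real `x ≥ 2` is attained -/
lemma exists_real (x : ℝ) (hx : 2 ≤ x) :
    ∃ w : ℕ → ℕ, delta w = ENNReal.ofReal x ∧ (x = 2 → Abundant w) := by
  obtain ⟨l, hl0, hls⟩ : ∃ l : ℕ → ℕ, l 0 = 0 ∧ ∀ k : ℕ, l (k+1) = ⌊x * (l k : ℝ)⌋₊ + 1 :=
    ⟨fun k => Nat.rec (motive := fun _ => ℕ) 0 (fun _ a => ⌊x * (a : ℝ)⌋₊ + 1) k, rfl, fun k => rfl⟩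
  have h1 : l 1 = 1 := by rw [hls, hl0]; simp
  have h2 : ∀ k, 2 * l k + 1 ≤ l (k+1) := by
    intro k
    rw [hls]
    have : 2 * l k ≤ ⌊x * l k⌋₊ := by
      apply Nat.le_floor
      push_cast
      gcongr
    omega
  have hm : StrictMono l := strictMono_nat_of_lt_succ (fun k => by have := h2 k; omega)
  obtain ⟨w, hw⟩ := exists_word l hl0 h1 h2
  obtain ⟨hi, hn⟩ := nth_eq hm hw
  refine ⟨w, ?_, ?_⟩
  · rw [delta_shift w hi 1, hn]
    apply Filter.Tendsto.limsup_eq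
    have hpos : ∀ i, 0 < l (i + 1) := fun i => by have := h2 i; omega
    have : ∀ i, (l (i + 1 + 1) : ENNReal) / (l (i + 1) : ENNReal) =
        ENNReal.ofReal ((l (i+1+1) : ℝ) / l (i+1)) := fun i => div_ofReal _ _ (hpos i)
    simp_rw [this]
    apply ENNReal.tendsto_ofReal
    have hinv : Tendsto (fun i => ((l (i+1) : ℝ))⁻¹) atTop (nhds 0) :=
      tendsto_inv_atTop_zero.comp (tendsto_natCast_atTop_atTop.comp
        (hm.tendsto_atTop.comp (tendsto_add_atTop_nat 1)))
    have hup : Tendsto (fun i => x + ((l (i+1) : ℝ))⁻¹) atTop (nhds x) := by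
      simpa using hinv.const_add x
    refine tendsto_of_tendsto_of_tendsto_of_le_of_le tendsto_const_nhds hup ?_ ?_
    · intro i
      have hp : (0:ℝ) < l (i+1) := by exact_mod_cast hpos i
      change x ≤ _
      rw [le_div_iff₀ hp, hls (i+1)]
      push_cast
      exact (Nat.lt_floor_add_one _).le
    · intro i
      have hp : (0:ℝ) < l (i+1) := by exact_mod_cast hpos i
      change _ ≤ x + (l (i+1) : ℝ)⁻¹
      rw [div_le_iff₀ hp, add_mul, inv_mul_cancel₀ hp.ne', hls (i+1)]
      push_cast
      have := Nat.floor_le (show 0 ≤ x * l (i+1) by positivity)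
      linarith
  · intro h
    refine ⟨hi, fun i => ?_⟩
    rw [hn, hls, h]
    have : ((2:ℝ) * l i) = ((2 * l i : ℕ) : ℝ) := by push_cast; ring
    rw [this, Nat.floor_natCast]

lemma delta_id : delta (fun n : ℕ => n) = ⊤ := by
  rw [delta, if_neg]
  rw [Set.not_infinite]
  change (Set.ofPred (palP _)).Finite
  apply (Set.finite_Iic 1).subset
  intro n hn
  have := (palP_iff _ n).1 hn 0
  simp at this ⊢
  omega

lemma nth_zero_pal {A : Type*} (w : ℕ → A) : Nat.nth (palP w) 0 = 0 := by
  rw [Nat.nth_zero]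
  exact le_antisymm (Nat.sInf_le (palP_zero w)) (Nat.zero_le _)

/-- transformation of a word with small gaps into an abundant one -/
lemma transform (w : ℕ → ℕ) (L N : ℕ) (n : ℕ → ℕ) (hn : StrictMono n)
    (hP : ∀ m, palP w m ↔ ∃ k, n k = m) (hL : n N = L) (hLpos : 0 < L)
    (hlow : ∀ m, palP w m → m < L → 2 * m < L)
    (hgap : ∀ i, N ≤ i → n (i + 1) ≤ 2 * n i) :
    ∃ W : ℕ → ℕ, ∀ m, palP W m ↔ m ≤ L ∨ ∃ i, N ≤ i ∧ m = 2 * n i + 1 := by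
  let Occ : ℕ → Prop := fun p => ∀ r, r < L → w (p + r) = w r
  have hpal : ∀ i, ∀ m, m < n i → w (n i - 1 - m) = w m := fun i =>
    (palP_iff w (n i)).1 ((hP _).2 ⟨i, rfl⟩)
  have hLpal : ∀ m, m < L → w (L - 1 - m) = w m := by
    intro m hm; have := hpal N m; rw [hL] at this; exact this hm
  have occ0 : Occ 0 := fun r _ => by rw [zero_add]
  -- mirror of occurrences
  have hmir : ∀ i q, Occ q → q + L ≤ n i → Occ (n i - L - q) := by
    intro i q hq hqi r hr
    have e := hpal i (q + (L - 1 - r)) (by omega)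
    rw [hq _ (by omega), hLpal r hr] at e
    rw [← e]
    congr 1; omega
  -- coverage
  have hcov : ∀ i, N ≤ i → ∀ k, k < n i → ∃ q, q ≤ k ∧ k < q + L ∧ Occ q ∧ q + L ≤ n i := by
    intro i hi
    induction i, hi using Nat.le_induction with
    | base => intro k hk; exact ⟨0, by omega, by omega, occ0, by omega⟩
    | succ i hi ih =>
      intro k hk
      have hlt : n i < n (i+1) := hn (Nat.lt_succ_self i)
      have hg := hgap i hi
      by_cases hk2 : k < n i
      · obtain ⟨q, h1, h2, h3, h4⟩ := ih k hk2
        exact ⟨q, h1, h2, h3, by omega⟩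
      · obtain ⟨q, h1, h2, h3, h4⟩ := ih (n (i+1) - 1 - k) (by omega)
        exact ⟨n (i+1) - L - q, by omega, by omega, hmir (i+1) q h3 (by omega), by omega⟩
  -- gaps
  have hsep : ∀ q q', Occ q → Occ q' → q < q' → L < 2 * (q' - q) := by
    intro q q' h h' hlt
    by_cases hc : L ≤ q' - q
    · omega
    have hp : palP w (L - (q' - q)) := by
      rw [palP_iff]
      intro m hm
      have e1 := hLpal (m + (q' - q)) (by omega)
      have e2 := h (m + (q' - q)) (by omega)
      have e3 := h' m (by omega)
      rw [show q + (m + (q' - q)) = q' + m by omega] at e2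
      rw [show L - (q' - q) - 1 - m = L - 1 - (m + (q' - q)) by omega]
      rw [e1, ← e2, e3]
    have := hlow _ hp (by omega)
    omega
  let W : ℕ → ℕ := fun m => if ∃ p, Occ p ∧ m = L + 2 * p then 1 else 0
  have hW1 : ∀ m, W m = 1 ↔ ∃ p, Occ p ∧ m = L + 2 * p := by
    intro m; simp only [W]; split_ifs with h <;> simp [h]
  have hW01 : ∀ m m', (W m = 1 ↔ W m' = 1) → W m = W m' := by
    intro m m'
    simp only [W]; split_ifs <;> simp
  refine ⟨W, fun m => ⟨fun hp => ?_, ?_⟩⟩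
  · by_cases hm : m ≤ L
    · exact Or.inl hm
    right
    rw [palP_iff] at hp
    have e := hp L (by omega)
    rw [(hW1 L).2 ⟨0, occ0, by omega⟩, hW1] at e
    obtain ⟨p, hop, hpe⟩ := e
    have hmp : m = 2 * (p + L) + 1 := by omega
    have hsym : ∀ q, Occ q → q ≤ p → Occ (p - q) := by
      intro q hq hqp
      have e := hp (L + 2 * q) (by omega)
      rw [(hW1 (L + 2 * q)).2 ⟨q, hq, rfl⟩, hW1] at e
      obtain ⟨q', hq', e'⟩ := e
      rwa [show p - q = q' by omega]
    have hpl : palP w (p + L) := by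
      rw [palP_iff]
      intro k hk
      have : ∃ q, q ≤ k ∧ k < q + L ∧ Occ q ∧ q ≤ p := by
        by_cases hkp : k < p
        · have hk' : k < n (N + k + 1) := lt_of_lt_of_le (show k < N + k + 1 by omega) (hn.id_le (N + k + 1))
          obtain ⟨q, h1, h2, h3, -⟩ := hcov (N + k + 1) (by omega) k hk'
          exact ⟨q, h1, h2, h3, by omega⟩
        · exact ⟨p, by omega, by omega, hop, le_rfl⟩
      obtain ⟨q, h1, h2, h3, h4⟩ := this
      have e1 := h3 (k - q) (by omega)
      have e2 := hsym q h3 h4 (L - 1 - (k - q)) (by omega)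
      rw [hLpal _ (by omega), ← e1] at e2
      rw [show p + L - 1 - k = p - q + (L - 1 - (k - q)) by omega, e2]
      congr 1; omega
    obtain ⟨i, hi⟩ := (hP _).1 hpl
    refine ⟨i, ?_, by omega⟩
    rw [← hn.le_iff_le]; omega
  · rintro (hm | ⟨i, hi, rfl⟩)
    · rw [palP_iff]
      intro k hk
      apply hW01
      rw [hW1, hW1]
      constructor
      · rintro ⟨p, -, h⟩; omega
      · rintro ⟨p, -, h⟩; omega
    · have hni : L ≤ n i := by rw [← hL]; exact hn.monotone hi
      have hoi : Occ (n i - L) := by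
        have := hmir i 0 occ0 (by omega)
        simpa using this
      have key : ∀ k, k < 2 * n i + 1 → W k = 1 → W (2 * n i + 1 - 1 - k) = 1 := by
        intro k hk h
        rw [hW1] at h ⊢
        obtain ⟨q, hq, rfl⟩ := h
        have hqi : q ≤ n i - L := by
          by_contra hc
          have := hsep _ _ hoi hq (by omega)
          omega
        exact ⟨n i - L - q, hmir i q hq (by omega), by omega⟩
      rw [palP_iff]
      intro k hk
      apply hW01
      constructor
      · intro h
        have := key _ (by omega) h
        rwa [show 2 * n i + 1 - 1 - (2 * n i + 1 - 1 - k) = k by omega] at this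
      · exact key k hk

lemma limsup_aux (n : ℕ → ℕ) (hn : StrictMono n) (hpos : ∀ i, 0 < n i)
    (hgap : ∀ i, n (i + 1) ≤ 2 * n i) :
    limsup (fun i => ((2 * n (i+1) + 1 : ℕ) : ENNReal) / ((2 * n i + 1 : ℕ) : ENNReal)) atTop =
    limsup (fun i => (n (i+1) : ENNReal) / (n i : ENNReal)) atTop := by
  have hb : ∀ i, (0:ℝ) < n i := fun i => by exact_mod_cast hpos i
  have hlt : ∀ i, (n i : ℝ) ≤ n (i+1) := fun i => by exact_mod_cast (hn (Nat.lt_succ_self i)).le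
  have hg : ∀ i, (n (i+1) : ℝ) ≤ 2 * n i := fun i => by exact_mod_cast hgap i
  apply le_antisymm
  · refine limsup_le_limsup (Eventually.of_forall ?_)
    intro i
    change _ / _ ≤ _ / _
    rw [div_ofReal _ _ (by omega), div_ofReal _ _ (hpos i)]
    apply ENNReal.ofReal_le_ofReal
    push_cast
    have := hb i
    rw [div_le_div_iff₀ (by positivity) this]
    nlinarith [hlt i]
  · have h0 : Tendsto (fun i => ENNReal.ofReal ((n i : ℝ)⁻¹)) atTop (nhds 0) := by
      rw [← ENNReal.ofReal_zero]
      apply ENNReal.tendsto_ofReal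
      exact tendsto_inv_atTop_zero.comp (tendsto_natCast_atTop_atTop.comp hn.tendsto_atTop)
    rw [← ENNReal.limsup_add_of_right_tendsto_zero h0 (fun i => ((2 * n (i+1) + 1 : ℕ) : ENNReal) / ((2 * n i + 1 : ℕ) : ENNReal))]
    refine limsup_le_limsup (Eventually.of_forall ?_)
    intro i
    change (n (i+1) : ENNReal) / (n i : ENNReal) ≤ ((2 * n (i+1) + 1 : ℕ) : ENNReal) / ((2 * n i + 1 : ℕ) : ENNReal) + ENNReal.ofReal ((n i : ℝ)⁻¹)
    have := hb i
    rw [div_ofReal _ _ (show 0 < 2 * n i + 1 by omega), div_ofReal _ _ (hpos i), ← ENNReal.ofReal_add (by positivity) (by positivity)]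
    apply ENNReal.ofReal_le_ofReal
    push_cast
    rw [inv_eq_one_div, div_add_div _ _ (by positivity) (by positivity), div_le_div_iff₀ (by positivity) (by positivity)]
    have h3 : (n (i+1) : ℝ) * (2 * n i + 1) ≤ (2 * n (i+1) + 1) * n i + (2 * n i + 1) := by
      nlinarith [hlt i, hg i]
    nlinarith [mul_le_mul_of_nonneg_right h3 this.le]

lemma lt_two_case (w : ℕ → ℕ) (h : delta w < 2) : ∃ W : ℕ → ℕ, Abundant W ∧ delta W = delta w := by
  have hi : (setOf (palP w)).Infinite := by
    by_contra hc
    rw [delta, if_neg hc] at h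
    simp at h
  set n := Nat.nth (palP w) with hndef
  have hn : StrictMono n := Nat.nth_strictMono hi
  have hP : ∀ m, palP w m ↔ ∃ k, n k = m := by
    intro m
    have := Nat.range_nth_of_infinite hi
    have h2 : m ∈ Set.range n ↔ m ∈ Set.ofPred (palP w) := by rw [← this]
    exact h2.symm
  have hn0 : n 0 = 0 := nth_zero_pal w
  have hpos : ∀ i, 0 < i → 0 < n i := fun i hi => by have := hn hi; omega
  have hex : ∃ N, ∀ i, N ≤ i → n (i+1) ≤ 2 * n i := by
    have h' := h
    rw [delta, if_pos hi] at h'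
    have := eventually_lt_of_limsup_lt h'
    obtain ⟨N, hN⟩ := eventually_atTop.1 this
    refine ⟨N + 1, fun i hi => ?_⟩
    have h1 := hN i (by omega)
    change (n (i+1) : ENNReal) / (n i : ENNReal) < 2 at h1
    have hp := hpos i (by omega)
    have h2 := (ENNReal.div_le_iff (by exact_mod_cast hp.ne') (by simp)).1 h1.le
    exact_mod_cast h2
  let N := Nat.find hex
  have hN : ∀ i, N ≤ i → n (i+1) ≤ 2 * n i := Nat.find_spec hex
  obtain ⟨M, hM⟩ : ∃ M, N = M + 1 := by
    rcases hNN : N with _ | M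
    · have h1 := hN 0 (by omega)
      have h2 := hpos 1 (by omega)
      simp [hn0] at h1
      omega
    · exact ⟨M, rfl⟩
  have hMN : 2 * n M < n N := by
    by_contra hc
    have : N ≤ M := by
      apply Nat.find_min' hex
      intro i hiM
      rcases Nat.eq_or_lt_of_le hiM with rfl | hlt
      · rw [← hM]; omega
      · exact hN i (by omega)
    omega
  obtain ⟨W, hW⟩ := transform w (n N) N n hn hP rfl (hpos N (by omega)) (by
    intro m hm hlt
    obtain ⟨k, rfl⟩ := (hP m).1 hm
    have hk : k < N := hn.lt_iff_lt.1 hlt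
    have := hn.monotone (show k ≤ M by omega)
    omega) hN
  generalize hL : n N = L at *
  let l : ℕ → ℕ := fun k => if k ≤ L then k else 2 * n (k - (L + 1) + N) + 1
  have hl1 : ∀ k, k ≤ L → l k = k := fun k hk => if_pos hk
  have hl2 : ∀ k, l (k + (L + 1)) = 2 * n (k + N) + 1 := by
    intro k
    simp only [l]
    rw [if_neg (by omega)]
    congr 4; omega
  have hcase : ∀ k, k ≤ L ∨ ∃ j, k = j + (L + 1) := fun k => by
    by_cases hk : k ≤ L
    · exact Or.inl hk
    · exact Or.inr ⟨k - (L+1), by omega⟩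
  have hlm : StrictMono l := by
    apply strictMono_nat_of_lt_succ
    intro k
    rcases hcase k with hk | ⟨j, rfl⟩
    · rw [hl1 k hk]
      rcases Nat.eq_or_lt_of_le hk with rfl | hlt
      · have := hl2 0
        rw [zero_add, zero_add, hL] at this
        rw [this]; omega
      · rw [hl1 _ hlt]; omega
    · have : n (j + N) < n (j + N + 1) := hn (Nat.lt_succ_self (j + N))
      rw [hl2, show j + (L + 1) + 1 = (j + 1) + (L + 1) by omega, hl2,
        show j + 1 + N = (j + N) + 1 by omega]
      omega
  have hWl : ∀ m, palP W m ↔ ∃ k, l k = m := by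
    intro m
    rw [hW]
    constructor
    · rintro (hm | ⟨i, hi, rfl⟩)
      · exact ⟨m, hl1 m hm⟩
      · exact ⟨i - N + (L + 1), by rw [hl2, show i - N + N = i by omega]⟩
    · rintro ⟨k, rfl⟩
      rcases hcase k with hk | ⟨j, rfl⟩
      · left; rw [hl1 k hk]; exact hk
      · right; exact ⟨j + N, by omega, hl2 j⟩
  obtain ⟨hWi, hWn⟩ := nth_eq hlm hWl
  refine ⟨W, ⟨hWi, fun k => ?_⟩, ?_⟩
  · rw [hWn]
    rcases hcase k with hk | ⟨j, rfl⟩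
    · rw [hl1 k hk]
      rcases Nat.eq_or_lt_of_le hk with rfl | hlt
      · have := hl2 0
        rw [zero_add, zero_add, hL] at this
        rw [this]
      · rw [hl1 _ hlt]; omega
    · have := hN (j + N) (by omega)
      rw [hl2, show j + (L + 1) + 1 = (j + 1) + (L + 1) by omega, hl2,
        show j + 1 + N = (j + N) + 1 by omega]
      omega
  · rw [delta_shift W hWi (L + 1), delta_shift w hi N, hWn, ← hndef]
    have e := limsup_aux (fun i => n (i + N)) (fun a b hab => hn (by omega))
      (fun i => hpos _ (by omega)) (fun i => by
        have := hN (i + N) (by omega)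
        change n (i + 1 + N) ≤ _
        rwa [show i + 1 + N = i + N + 1 by omega])
    have e1 : ∀ i, l (i + (L + 1) + 1) = 2 * n (i + 1 + N) + 1 := by
      intro i
      rw [show i + (L + 1) + 1 = (i + 1) + (L + 1) by omega, hl2]
    have e2 : ∀ i, i + N + 1 = i + 1 + N := fun i => by omega
    simp_rw [e1, hl2, e2]
    exact e

lemma abundant_Icc (w : ℕ → ℕ) (hw : Abundant w) : delta w ∈ Set.Icc (1 : ENNReal) 2 := by
  obtain ⟨hi, hg⟩ := hw
  rw [delta_shift w hi 1]
  set n := Nat.nth (palP w) with hndef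
  have hn : StrictMono n := Nat.nth_strictMono hi
  have hpos : ∀ i, 0 < n (i + 1) := fun i => by
    have := hn (Nat.succ_pos i); exact lt_of_le_of_lt (Nat.zero_le _) this
  constructor
  · apply le_limsup_of_frequently_le'
    apply Eventually.frequently
    apply Eventually.of_forall
    intro i
    have hp := hpos i
    rw [ENNReal.le_div_iff_mul_le (Or.inl (by exact_mod_cast hp.ne')) (Or.inl (by simp)), one_mul]
    exact_mod_cast (hn (Nat.lt_succ_self (i+1))).le
  · have h0 : Tendsto (fun i => ENNReal.ofReal ((n (i+1) : ℝ)⁻¹)) atTop (nhds 0) := by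
      rw [← ENNReal.ofReal_zero]
      apply ENNReal.tendsto_ofReal
      exact tendsto_inv_atTop_zero.comp (tendsto_natCast_atTop_atTop.comp
        (hn.tendsto_atTop.comp (tendsto_add_atTop_nat 1)))
    have h2 : limsup ((fun _ : ℕ => (2 : ENNReal)) + fun i => ENNReal.ofReal ((n (i+1) : ℝ)⁻¹)) atTop = 2 := by
      rw [ENNReal.limsup_add_of_right_tendsto_zero h0, limsup_const]
    rw [← h2]
    refine limsup_le_limsup (Eventually.of_forall ?_)
    intro i
    change _ / _ ≤ (2 : ENNReal) + _
    have hp : (0:ℝ) < n (i+1) := by exact_mod_cast hpos i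
    rw [div_ofReal _ _ (hpos i), show (2 : ENNReal) = ENNReal.ofReal 2 by simp,
      ← ENNReal.ofReal_add (by norm_num) (by positivity)]
    apply ENNReal.ofReal_le_ofReal
    rw [div_le_iff₀ hp, add_mul, inv_mul_cancel₀ hp.ne']
    exact_mod_cast hg (i+1)

theorem stmt0 :
    {x : ENNReal | ∃ w : ℕ → ℕ, Abundant w ∧ delta w = x} ⊆ Set.Icc 1 2 ∧
    {x : ENNReal | ∃ w : ℕ → ℕ, delta w = x} =
      {x : ENNReal | ∃ w : ℕ → ℕ, Abundant w ∧ delta w = x} ∪ Set.Ioi 2 ∧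
    Disjoint {x : ENNReal | ∃ w : ℕ → ℕ, Abundant w ∧ delta w = x} (Set.Ioi 2) := by
  have hsub : {x : ENNReal | ∃ w : ℕ → ℕ, Abundant w ∧ delta w = x} ⊆ Set.Icc 1 2 := by
    rintro x ⟨w, hw, rfl⟩
    exact abundant_Icc w hw
  refine ⟨hsub, ?_, ?_⟩
  · apply Set.Subset.antisymm
    · rintro x ⟨w, rfl⟩
      rcases lt_trichotomy (delta w) 2 with h | h | h
      · left; exact lt_two_case w h
      · left
        obtain ⟨W, h1, h2⟩ := exists_real 2 le_rfl
        refine ⟨W, h2 rfl, ?_⟩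
        rw [h1, h]; simp
      · right; exact h
    · rintro x (⟨w, -, hw⟩ | hx)
      · exact ⟨w, hw⟩
      · by_cases ht : x = ⊤
        · exact ⟨_, ht ▸ delta_id⟩
        · have hx2 : (2 : ENNReal) < x := hx
          obtain ⟨W, h1, -⟩ := exists_real x.toReal (by
            have := ENNReal.toReal_mono ht hx2.le
            simpa using this)
          exact ⟨W, by rw [h1, ENNReal.ofReal_toReal ht]⟩
  · rw [Set.disjoint_left]
    intro x hx hx'
    exact absurd (hsub hx).2 (not_le.2 hx')
end

section
/- Let w be an infinite word on an alphabet A whose set P(w) of lengths of palindromic prefixes is infinite, with increasing enumeration (n_i)_{i≥1}. If limsup_{i→∞} n_{i+1}/n_i < (1+√5)/2 (the golden ratio), then w is periodic: there exists d ≥ 1 such that w(n+d) = w(n) for all n ≥ 0. -/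
open Filter

theorem palP_iff_aux {A : Type*} (w : ℕ → A) (n : ℕ) :
    palP w n ↔ ∀ i j, i + j + 1 = n → w i = w j := by
  unfold palP pref
  rw [List.Palindrome.iff_reverse_eq]
  constructor
  · intro h i j hij
    have h1 := congrArg (fun l => l[i]?) h
    have hi : i < n := by omega
    have hj : n - 1 - i = j := by omega
    have hjn : j < n := by omega
    simp [List.getElem?_reverse, hi, hj, hjn] at h1
    exact h1.symm
  · intro h
    apply List.ext_getElem
    · simp
    · intro i h1 h2
      simp at h1 h2
      simp
      apply h
      omega

theorem per_of_pal {A : Type*} (w : ℕ → A) {p n : ℕ} (hpn : p ≤ n) (hp : palP w p)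
    (hn : palP w n) : ∀ k, k + (n - p) < n → w (k + (n - p)) = w k := by
  rw [palP_iff_aux] at hp hn
  intro k hk
  rw [hp k (p - 1 - k) (by omega)]
  exact hn _ _ (by omega)

theorem pal_of_per {A : Type*} (w : ℕ → A) {d n : ℕ} (hn : palP w n)
    (hd : ∀ k, k + d < n → w (k + d) = w k) : palP w (n - d) := by
  rw [palP_iff_aux] at hn ⊢
  intro i j hij
  rw [← hd j (by omega)]
  exact hn _ _ (by omega)

theorem step_aux {A : Type*} (w : ℕ → A) {a b c : ℕ} (hab : a < b) (hbc : b < c)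
    (ha : palP w a) (hb : palP w b) (hc : palP w c)
    (h1 : ∀ m, a < m → m < b → ¬ palP w m) (h2 : ∀ m, b < m → m < c → ¬ palP w m)
    (hs : c ≤ a + b) : c - b = b - a := by
  have pe := per_of_pal w hbc.le hb hc
  have pd := per_of_pal w hab.le ha hb
  rcases lt_trichotomy (c - b) (b - a) with hlt | heq | hgt
  · exact absurd (pal_of_per w hb (d := c - b) (fun k hk => pe k (by omega)))
      (h1 _ (by omega) (by omega))
  · exact heq
  · refine absurd (pal_of_per w hc (d := b - a) (fun k hk => ?_)) (h2 _ (by omega) (by omega))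
    by_cases hkb : k + (b - a) < b
    · exact pd k hkb
    · have e1 := pe (k + (b - a) - (c - b)) (by omega)
      have e2 := pe (k - (c - b)) (by omega)
      have e3 := pd (k - (c - b)) (by omega)
      rw [show k + (b - a) - (c - b) + (c - b) = k + (b - a) by omega] at e1
      rw [show k - (c - b) + (c - b) = k by omega] at e2
      rw [show k - (c - b) + (b - a) = k + (b - a) - (c - b) by omega] at e3
      rw [e1, e2, e3]

theorem stmt2 {A : Type*} (w : ℕ → A)
    (hinf : (setOf (palP w)).Infinite)
    (h : limsup (fun i => (Nat.nth (palP w) (i + 1) : ENNReal) / (Nat.nth (palP w) i : ENNReal))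
        atTop < ENNReal.ofReal ((1 + Real.sqrt 5) / 2)) :
    ∃ d : ℕ, 1 ≤ d ∧ ∀ n, w (n + d) = w n := by
  have hev := eventually_lt_of_limsup_lt h
  obtain ⟨N, hN⟩ := eventually_atTop.1 hev
  have hmono := Nat.nth_strictMono hinf
  have hpal : ∀ i, palP w (Nat.nth (palP w) i) := fun i => Nat.nth_mem_of_infinite hinf i
  have hgap : ∀ i m, Nat.nth (palP w) i < m → m < Nat.nth (palP w) (i + 1) → ¬ palP w m := by
    intro i m h1 h2 h3
    classical
    have h4 := Nat.nth_count h3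
    rw [← h4] at h1 h2
    have h5 := hmono.lt_iff_lt.1 h1
    have h6 := hmono.lt_iff_lt.1 h2
    omega
  generalize Nat.nth (palP w) = n at *
  have hr : ∀ i, N ≤ i → 1 ≤ i → (n (i + 1) : ℝ) < (1 + Real.sqrt 5) / 2 * n i := by
    intro i hi h1
    have hpos : 0 < n i := lt_of_le_of_lt (Nat.zero_le _) (hmono (show 0 < i by omega))
    have h2 := hN i hi
    rw [ENNReal.div_lt_iff (Or.inl (by exact_mod_cast hpos.ne')) (Or.inl (by simp))] at h2
    rw [← ENNReal.ofReal_natCast (n i), ← ENNReal.ofReal_natCast (n (i+1)),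
      ← ENNReal.ofReal_mul (by positivity)] at h2
    exact (ENNReal.ofReal_lt_ofReal_iff_of_nonneg (by positivity)).1 h2
  have hs : ∀ i, N + 1 ≤ i → n (i + 2) - n (i + 1) = n (i + 1) - n i := by
    intro i hi
    refine step_aux w (hmono (by omega)) (hmono (by omega)) (hpal _) (hpal _) (hpal _)
      (hgap i) (hgap (i + 1)) ?_
    by_contra hcon
    have hcon : (n i : ℝ) + n (i + 1) < n (i + 2) := by exact_mod_cast not_le.1 hcon
    have a1 := hr i (by omega) (by omega)
    have a2 := hr (i + 1) (by omega) (by omega)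
    have s5 : Real.sqrt 5 ^ 2 = 5 := Real.sq_sqrt (by norm_num)
    have s1 : 1 < Real.sqrt 5 := by
      rw [Real.lt_sqrt] <;> norm_num
    rw [show i + 1 + 1 = i + 2 by rfl] at a2
    have a3 : (n i : ℝ) < (Real.sqrt 5 - 1) / 2 * n (i + 1) := by linarith
    have a4 := mul_lt_mul_of_pos_left a3 (show 0 < (1 + Real.sqrt 5) / 2 by positivity)
    have a5 : (1 + Real.sqrt 5) / 2 * ((Real.sqrt 5 - 1) / 2 * n (i + 1)) = n (i + 1) := by
      linear_combination (n (i + 1) : ℝ) / 4 * s5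
    linarith
  have hd : ∀ j, n (N + 1 + j + 1) - n (N + 1 + j) = n (N + 2) - n (N + 1) := by
    intro j
    induction j with
    | zero => rfl
    | succ j ih => rw [← ih]; exact hs (N + 1 + j) (by omega)
  refine ⟨n (N + 2) - n (N + 1), ?_, ?_⟩
  · have := hmono (show N + 1 < N + 2 by omega)
    omega
  · intro k
    set d := n (N + 2) - n (N + 1) with hdd
    have hp := per_of_pal w (hmono (show N + 1 + (k + d) < N + 1 + (k + d) + 1 by omega)).le
      (hpal _) (hpal _) k
    rw [hd] at hp
    apply hp
    have := hmono.id_le (N + 1 + (k + d) + 1)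
    simp at this
    omega
end

section
/- Let w be an infinite word on an alphabet A, and let n, n', n'' be natural numbers with n' ≤ n'' ≤ n + n'. Assume the prefixes of w of lengths n, n', n'' are palindromes, denoted a, a', a'' respectively, and let a₀ be the prefix of w of length n + n' − n''. Then: (1) there exists a finite word b such that a = a₀b and a'' = a'b; (2) if moreover n'' ≥ n − n', then a₀ is a palindrome. -/
theorem pref_pal_iff {A : Type*} (w : ℕ → A) (n : ℕ) :
    (pref w n).Palindrome ↔ ∀ i j, i + j + 1 = n → w i = w j := by
  rw [List.Palindrome.iff_reverse_eq]
  constructor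
  · intro h i j hij
    have h2 : (pref w n).reverse[i]? = (pref w n)[i]? := by rw [h]
    have hi : i < (pref w n).length := by simp [pref]; omega
    rw [List.getElem?_reverse hi] at h2
    have e : (pref w n).length - 1 - i = j := by simp [pref]; omega
    rw [e] at h2
    have hj : j < n := by omega
    have hi : i < n := by omega
    simp [pref, hi, hj] at h2
    exact h2.symm
  · intro h
    apply List.ext_getElem
    · simp
    · intro i h1 h2
      simp only [pref, List.getElem_reverse, List.getElem_map, List.getElem_range,
        List.length_map, List.length_range] at h2 ⊢
      apply h; omega

theorem pref_add {A : Type*} (w : ℕ → A) (m d : ℕ) :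
    pref w (m + d) = pref w m ++ (List.range d).map (fun j => w (m + j)) := by
  simp [pref, List.range_add]

theorem stmt5 {A : Type*} (w : ℕ → A) (n n' n'' : ℕ)
    (h1 : n' ≤ n'') (h2 : n'' ≤ n + n')
    (ha : (pref w n).Palindrome) (ha' : (pref w n').Palindrome)
    (ha'' : (pref w n'').Palindrome) :
    (∃ b : List A, pref w n = pref w (n + n' - n'') ++ b ∧
      pref w n'' = pref w n' ++ b) ∧
    (n - n' ≤ n'' → (pref w (n + n' - n'')).Palindrome) := by
  rw [pref_pal_iff] at ha ha' ha''
  obtain ⟨d, rfl⟩ := Nat.exists_eq_add_of_le h1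
  obtain ⟨m, rfl⟩ : ∃ m, n = m + d := ⟨n - d, by omega⟩
  have e : m + d + n' - (n' + d) = m := by omega
  rw [e]
  refine ⟨⟨(List.range d).map (fun j => w (m + j)), pref_add w m d, ?_⟩, ?_⟩
  · rw [pref_add]
    congr 1
    apply List.map_congr_left
    intro j hj
    rw [List.mem_range] at hj
    rw [ha (m + j) (d - 1 - j) (by omega), ha'' (n' + j) (d - 1 - j) (by omega)]
  · intro h
    rw [pref_pal_iff]
    have key : ∀ i j, i + j + 1 = m → i < n' → w i = w j := by
      intro i j hij hi
      rw [ha' i (n' - 1 - i) (by omega), ha'' (n' - 1 - i) (d + i) (by omega),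
        ha (d + i) j (by omega)]
    intro i j hij
    by_cases hi : i < n'
    · exact key i j hij hi
    · exact (key j i (by omega) (by omega)).symm
end

section
/- Let ψ be an admissible function on an alphabet A, (π_i)_{i≥1} the associated sequence of palindromes and w_ψ the associated infinite word. Then ψ is reduced if and only if the palindromic prefixes of w_ψ are exactly the words π_i, i.e., a finite word is both a prefix of w_ψ and a palindrome if and only if it equals π_i for some i ≥ 1. -/
open Filter

/-- An admissible function: index `i : ℕ` stands for the paper's index `i + 1`, and the
value `Sum.inr j` stands for the paper's integer value `j + 1`; so the paper's condition
`1 ≤ ψ(n) ≤ n - 1` becomes `j < i`. -/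
def Admissible {A : Type*} (ψ : ℕ → A ⊕ ℕ) : Prop :=
  ∀ i j, ψ i = Sum.inr j → j < i

/-- The set `S(ψ)` of indices `n` with `ψ(n) ∈ A` or `ψ(n) ≤ n - 2` (in the paper's
indexing; here `i` stands for `n = i + 1` and `Sum.inr j` for the value `j + 1`). -/
def Sset {A : Type*} (ψ : ℕ → A ⊕ ℕ) : Set ℕ :=
  {i | (∃ a, ψ i = Sum.inl a) ∨ ∃ j, ψ i = Sum.inr j ∧ j + 2 ≤ i}

/-- `m < n` are consecutive elements of `S`. -/
def ConsecIn (S : Set ℕ) (m n : ℕ) : Prop :=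
  m ∈ S ∧ n ∈ S ∧ m < n ∧ ∀ k ∈ S, ¬(m < k ∧ k < n)

/-- `ψ` is reduced: for consecutive `m < n` in `S(ψ)`, `ψ(n) ≠ ψ(m)` and either
`ψ(n) ∈ A` or `ψ(n) < m` (in the paper's indexing: `Sum.inr j` stands for the value
`j + 1` and `m` for the index `m + 1`, so the paper's `ψ(n) < m` becomes `j < m`). -/
def Reduced {A : Type*} (ψ : ℕ → A ⊕ ℕ) : Prop :=
  ∀ m n, ConsecIn (Sset ψ) m n →
    ψ n ≠ ψ m ∧ ((∃ a, ψ n = Sum.inl a) ∨ ∃ j, ψ n = Sum.inr j ∧ j < m)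

/-- The palindromes `π_i` associated with `ψ` (`piW ψ i` is the paper's `π_{i+1}`):
`π_1 = ε`; `π_{i+1} = π_i a π_i` if `ψ(i) = a ∈ A`, and `π_{i+1} = π_i u` where `u` is
`π_i` with its first `|π_j|` letters deleted if `ψ(i) = j ∈ ℕ*`. (The `min j i` is
irrelevant when `ψ` is admissible, since then `j < i`.) -/
def piW {A : Type*} (ψ : ℕ → A ⊕ ℕ) : ℕ → List A
  | 0 => []
  | (i + 1) =>
    match ψ i with
    | Sum.inl a => piW ψ i ++ a :: piW ψ i
    | Sum.inr j => piW ψ i ++ (piW ψ i).drop (piW ψ (min j i)).length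

/-- The sequence `(n_i)` associated with `ψ` (`nseq ψ i` is the paper's `n_{i+1}`). -/
def nseq {A : Type*} (ψ : ℕ → A ⊕ ℕ) : ℕ → ℕ
  | 0 => 0
  | (i + 1) =>
    match ψ i with
    | Sum.inl _ => 2 * nseq ψ i + 1
    | Sum.inr j => 2 * nseq ψ i - nseq ψ (min j i)

/-- `δ(ψ) = limsup n_{i+1} / n_i`. -/
noncomputable def deltaPsi {A : Type*} (ψ : ℕ → A ⊕ ℕ) : ENNReal :=
  limsup (fun i => (nseq ψ (i + 1) : ENNReal) / (nseq ψ i : ENNReal)) atTop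


namespace PalAux

def Per {A : Type*} (w : ℕ → A) (d L : ℕ) : Prop := ∀ i, i + d < L → w i = w (i + d)

def Pal {A : Type*} (w : ℕ → A) (L : ℕ) : Prop := ∀ i j, i + j + 1 = L → w i = w j

theorem per_mod {A : Type*} {w : ℕ → A} {d L : ℕ} (h : Per w d L) :
    ∀ x, x < L → w x = w (x % d) := by
  intro x
  induction x using Nat.strong_induction_on with
  | _ x ih =>
    intro hx
    by_cases hd : d = 0
    · subst hd; simp
    by_cases hxd : x < d
    · rw [Nat.mod_eq_of_lt hxd]
    · have h1 := h (x - d) (by omega)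
      rw [Nat.sub_add_cancel (by omega)] at h1
      rw [← h1, ih (x - d) (by omega) (by omega), Nat.mod_eq_sub_mod (by omega : x ≥ d)]

theorem of_mod {A : Type*} {w : ℕ → A} {d L : ℕ} (h : ∀ x, x < L → w x = w (x % d)) :
    Per w d L := by
  intro i hi
  rw [h i (by omega), h (i + d) hi, Nat.add_mod_right]

theorem per_ext {A : Type*} {w : ℕ → A} {d D L : ℕ} (hD : Per w D L) (hD0 : 0 < D)
    (h : ∀ x, x < D → w x = w (x % d)) (hd : d ∣ D) : Per w d L := by
  apply of_mod
  intro x hx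
  rw [per_mod hD x hx, h _ (Nat.mod_lt _ hD0), Nat.mod_mod_of_dvd _ hd]

theorem per_mul {A : Type*} {w : ℕ → A} {d D L : ℕ} (h : Per w d L) (hd : d ∣ D) :
    Per w D L := by
  intro i hi
  obtain ⟨k, rfl⟩ := hd
  rw [per_mod h i (by omega), per_mod h _ hi, Nat.add_mul_mod_self_left]

theorem per_mono {A : Type*} {w : ℕ → A} {d L L' : ℕ} (h : Per w d L) (hL : L' ≤ L) :
    Per w d L' := fun i hi => h i (by omega)

theorem pal_per {A : Type*} {w : ℕ → A} {p q : ℕ} (hp : Pal w p) (hq : Pal w q) (h : p ≤ q) :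
    Per w (q - p) q := by
  intro i hi
  have h1 := hp i (p - 1 - i) (by omega)
  have h2 := hq (i + (q - p)) (p - 1 - i) (by omega)
  rw [h1, h2]

theorem per_pal {A : Type*} {w : ℕ → A} {d q : ℕ} (hq : Pal w q) (h : Per w d q) :
    Pal w (q - d) := by
  intro i j hij
  rw [h i (by omega)]
  exact hq _ _ (by omega)

theorem pal_ext {A : Type*} {w : ℕ → A} {p d : ℕ} (hp : Pal w p) (h : Per w d (p + d))
    (hd : d ≤ p + 1) : Pal w (p + d) := by
  intro i j hij
  by_cases hj : d ≤ j
  · have h1 := h (j - d) (by omega)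
    rw [Nat.sub_add_cancel hj] at h1
    rw [← h1]
    exact hp _ _ (by omega)
  by_cases hi : d ≤ i
  · have h1 := h (i - d) (by omega)
    rw [Nat.sub_add_cancel hi] at h1
    rw [← h1]
    exact hp _ _ (by omega)
  have : i = j := by omega
  rw [this]

theorem per_sub {A : Type*} {w : ℕ → A} {p q L : ℕ} (hp : Per w p L) (hq : Per w q L)
    (hpq : p ≤ q) (hL : p + q ≤ L) : Per w (q - p) L := by
  intro i hi
  by_cases hip : p ≤ i
  · have h1 := hp (i - p) (by omega)
    have h2 := hq (i - p) (by omega)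
    rw [Nat.sub_add_cancel hip] at h1
    rw [← h1, h2]; congr 1; omega
  · have h1 := hq i (by omega)
    have h2 := hp (i + (q - p)) (by omega)
    rw [h1, h2]; congr 1; omega

theorem fine_wilf {A : Type*} {w : ℕ → A} {L : ℕ} : ∀ (s p q : ℕ), p + q ≤ s → Per w p L →
    Per w q L → p + q ≤ L → Per w (Nat.gcd p q) L := by
  intro s
  induction s with
  | zero => intro p q h hp hq hL
            have : p = 0 := by omega
            subst this; simpa using hq
  | succ s ih =>
    intro p q h hp hq hL
    by_cases hp0 : p = 0
    · subst hp0; simpa using hq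
    by_cases hq0 : q = 0
    · subst hq0; simpa using hp
    rcases le_total p q with hpq | hpq
    · have := ih p (q - p) (by omega) hp (per_sub hp hq hpq hL) (by omega)
      rwa [Nat.gcd_sub_self_right hpq] at this
    · have := ih (p - q) q (by omega) (per_sub hq hp hpq (by omega)) hq (by omega)
      rwa [Nat.gcd_sub_self_left hpq] at this

structure Sys {A : Type*} (ψ : ℕ → A ⊕ ℕ) (w : ℕ → A) (N : ℕ → ℕ) : Prop where
  zero : N 0 = 0
  mono : StrictMono N
  pal : ∀ i, Pal w (N i)
  inl : ∀ i a, ψ i = Sum.inl a → N (i + 1) = 2 * N i + 1 ∧ w (N i) = a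
  inr : ∀ i j, ψ i = Sum.inr j → j < i ∧ N (i + 1) + N j = 2 * N i

variable {A : Type*} {ψ : ℕ → A ⊕ ℕ} {w : ℕ → A} {N : ℕ → ℕ}

theorem Sys.gap (hs : Sys ψ w N) {k i : ℕ} (h1 : N k < N i) (h2 : N i < N (k + 1)) : False := by
  have := hs.mono.lt_iff_lt.1 h1
  have := hs.mono.lt_iff_lt.1 h2
  omega

theorem Sys.chain (hs : Sys ψ w N) {m n : ℕ} (hc : ConsecIn (Sset ψ) m n) :
    ∀ t, m + t ≤ n → N (m + t) = N m + t * (N (m + 1) - N m) := by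
  intro t
  induction t using Nat.strong_induction_on with
  | _ t ih =>
    intro ht
    match t, ih, ht with
    | 0, _, _ => simp
    | 1, _, _ => have := hs.mono (Nat.lt_succ_self m)
                 simp only [Nat.succ_eq_add_one] at this; omega
    | t + 2, ih, ht =>
      have h1 := ih t (by omega) (by omega)
      have h2 := ih (t + 1) (by omega) (by omega)
      have h3 : m + (t + 1) ∉ Sset ψ := fun h => hc.2.2.2 _ h ⟨by omega, by omega⟩
      cases hψ : ψ (m + (t + 1)) with
      | inl a => exact absurd (Or.inl ⟨a, hψ⟩) h3
      | inr j =>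
        have h4 : ¬ (j + 2 ≤ m + (t + 1)) := fun h => h3 (Or.inr ⟨j, hψ, h⟩)
        obtain ⟨h5, h6⟩ := hs.inr _ _ hψ
        have h7 : j = m + t := by omega
        subst h7
        have h8 : m + (t + 1) + 1 = m + (t + 2) := by omega
        rw [h8] at h6
        have e1 : (t + 1) * (N (m + 1) - N m) = t * (N (m + 1) - N m) + (N (m + 1) - N m) := by ring
        have e2 : (t + 2) * (N (m + 1) - N m) = t * (N (m + 1) - N m) + 2 * (N (m + 1) - N m) := by
          ring
        omega

theorem Sys.chain_per (hs : Sys ψ w N) {m n : ℕ} (hc : ConsecIn (Sset ψ) m n) :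
    Per w (N (m + 1) - N m) (N n) ∧ N n - N (n - 1) = N (m + 1) - N m := by
  have hmn := hc.2.2.1
  obtain ⟨t, rfl⟩ : ∃ t, n = m + (t + 1) := ⟨n - m - 1, by omega⟩
  have h1 := hs.chain hc (t + 1) le_rfl
  have h2 := hs.chain hc t (by omega)
  have e1 : (t + 1) * (N (m + 1) - N m) = t * (N (m + 1) - N m) + (N (m + 1) - N m) := by ring
  have h3 : m + (t + 1) - 1 = m + t := by omega
  have h4 : N (m + (t + 1)) - N (m + t) = N (m + 1) - N m := by omega
  rw [h3]
  refine ⟨?_, h4⟩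
  rw [← h4]
  exact pal_per (hs.pal _) (hs.pal _) (hs.mono.monotone (by omega))

theorem Sys.bad (hs : Sys ψ w N) (hall : ∀ L, Pal w L → ∃ i, L = N i) {n d : ℕ} (hd0 : 0 < d)
    (hd : d ∣ N (n + 1) - N n) (h2 : 2 * d ≤ N (n + 1) - N n)
    (h : ∀ x, x < N (n + 1) - N n → w x = w (x % d)) : False := by
  have hm : N n < N (n + 1) := hs.mono (Nat.lt_succ_self n)
  have hP : Per w d (N (n + 1)) :=
    per_ext (pal_per (hs.pal _) (hs.pal _) hm.le) (by omega) h hd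
  have h3 : d ∣ N (n + 1) - N n - d := Nat.dvd_sub hd dvd_rfl
  obtain ⟨i, hi⟩ := hall _ (per_pal (hs.pal _) (per_mul hP h3))
  exact hs.gap (k := n) (i := i) (by omega) (by omega)

theorem Sys.backward (hs : Sys ψ w N) (hall : ∀ L, Pal w L → ∃ i, L = N i) : Reduced ψ := by
  intro m n hc
  obtain ⟨hper, -⟩ := hs.chain_per hc
  have hmn := hc.2.2.1
  have hch := hs.chain hc
  have hd0 : 0 < N (m + 1) - N m := by
    have : N m < N (m + 1) := hs.mono (Nat.lt_succ_self m)
    omega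
  obtain ⟨t, rfl⟩ : ∃ t, n = m + (t + 1) := ⟨n - m - 1, by omega⟩
  have hn := hch _ le_rfl
  have hbad := hs.bad hall (n := m + (t + 1)) hd0
  have hmlt : N m < N (m + 1) := hs.mono (Nat.lt_succ_self m)
  set d := N (m + 1) - N m with hd
  have e1 : (t + 1) * d = t * d + d := by ring
  constructor
  · intro heq
    cases hψ : ψ m with
    | inl a =>
      rw [hψ] at heq
      obtain ⟨h1, h2⟩ := hs.inl _ _ hψ
      obtain ⟨h3, h4⟩ := hs.inl _ _ heq
      have hdm : d = N m + 1 := by omega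
      have hD : N (m + (t + 1) + 1) - N (m + (t + 1)) = d * (t + 2) := by
        have : d * (t + 2) = t * d + 2 * d := by ring
        omega
      refine hbad ⟨_, hD⟩ ?_ ?_
      · rw [hD]; nlinarith
      · intro x hx
        rcases Nat.lt_or_ge x (N (m + (t + 1))) with hx' | hx'
        · exact per_mod hper x hx'
        · have hx2 : x = N (m + (t + 1)) := by omega
          have : x % d = N m := by
            rw [hx2, hn, Nat.add_mul_mod_self_right, Nat.mod_eq_of_lt (by omega)]
          rw [this, hx2, h4, h2]
    | inr j =>
      rw [hψ] at heq
      obtain ⟨h1, h2⟩ := hs.inr _ _ hψ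
      obtain ⟨h3, h4⟩ := hs.inr _ _ heq
      have hD : N (m + (t + 1) + 1) - N (m + (t + 1)) = d * (t + 2) := by
        have : d * (t + 2) = t * d + 2 * d := by ring
        omega
      refine hbad ⟨_, hD⟩ ?_ ?_
      · rw [hD]; nlinarith
      · intro x hx
        exact per_mod hper x (by omega)
  · cases hψ : ψ (m + (t + 1)) with
    | inl a => exact Or.inl ⟨a, rfl⟩
    | inr j =>
      refine Or.inr ⟨j, rfl, ?_⟩
      by_contra hj
      have hS := hc.2.1
      rcases hS with ⟨a, ha⟩ | ⟨j', hj', hjS⟩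
      · rw [hψ] at ha; cases ha
      rw [hψ] at hj'
      cases hj'
      obtain ⟨h3, h4⟩ := hs.inr _ _ hψ
      obtain ⟨s, rfl⟩ : ∃ s, j = m + s := ⟨j - m, by omega⟩
      have hs' := hch s (by omega)
      obtain ⟨r, hr⟩ : ∃ r, t + 1 = s + (r + 2) := ⟨t + 1 - s - 2, by omega⟩
      have e2 : (t + 1) * d = s * d + d * (r + 2) := by rw [hr]; ring
      have hD : N (m + (t + 1) + 1) - N (m + (t + 1)) = d * (r + 2) := by omega
      refine hbad ⟨_, hD⟩ ?_ ?_
      · rw [hD]; nlinarith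
      · intro x hx
        exact per_mod hper x (by omega)

def P (w : ℕ → A) (N : ℕ → ℕ) (n : ℕ) : Prop := ∀ L, L ≤ N n → Pal w L → ∃ i, L = N i

theorem Sys.min (hs : Sys ψ w N) {n g : ℕ} (hP : P w N n) (hg : 0 < g) (hgn : g ≤ N n)
    (h : Per w g (N n)) : N n - N (n - 1) ≤ g := by
  obtain ⟨i, hi⟩ := hP _ (Nat.sub_le _ _) (per_pal (hs.pal n) h)
  have h1 : i < n := hs.mono.lt_iff_lt.1 (by omega)
  have h2 : N i ≤ N (n - 1) := hs.mono.monotone (by omega)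
  omega

theorem Sys.dvd (hs : Sys ψ w N) {n g : ℕ} (hP : P w N n) (hn : 1 ≤ n) (hg : 0 < g)
    (h : Per w g (N n)) (hgd : g + (N n - N (n - 1)) ≤ N n) : N n - N (n - 1) ∣ g := by
  have hlt : N (n - 1) < N n := hs.mono (by omega)
  have h1 := fine_wilf _ _ _ le_rfl h (pal_per (hs.pal (n - 1)) (hs.pal n) hlt.le) hgd
  have hpos : 0 < Nat.gcd g (N n - N (n - 1)) := Nat.gcd_pos_of_pos_left _ hg
  have hle := Nat.gcd_le_left (N n - N (n - 1)) hg
  have h2 := hs.min hP hpos (by omega) h1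
  have h3 := Nat.gcd_le_right (m := g) (n := N n - N (n - 1)) (by omega)
  have h4 : Nat.gcd g (N n - N (n - 1)) = N n - N (n - 1) := by omega
  rw [← h4]
  exact Nat.gcd_dvd_left _ _

theorem Sys.step1 (hs : Sys ψ w N) {n q : ℕ} (hP : P w N n) (hn : 1 ≤ n) (hq : Pal w q)
    (h1 : N n < q) (h2 : q < N (n + 1)) (hle : N (n + 1) ≤ 2 * N n + 1) :
    Per w (N n - N (n - 1)) (N (n + 1)) ∧ N n - N (n - 1) ∣ N (n + 1) - N n ∧
      2 * (N n - N (n - 1)) ≤ N (n + 1) - N n := by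
  have hlt : N (n - 1) < N n := hs.mono (by omega)
  have a1 := pal_per (hs.pal n) hq h1.le
  have a2 := pal_per hq (hs.pal (n + 1)) h2.le
  have a3 := pal_per (hs.pal n) (hs.pal (n + 1)) (h1.trans h2).le
  have f := fine_wilf _ _ _ le_rfl a1 (per_mono a2 h2.le) (by omega)
  set g := Nat.gcd (q - N n) (N (n + 1) - q) with hg
  have hgpos : 0 < g := Nat.gcd_pos_of_pos_left _ (by omega)
  have g1 : g ≤ q - N n := Nat.gcd_le_left _ (by omega)
  have g2 : g ≤ N (n + 1) - q := Nat.gcd_le_right _ (by omega)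
  have gD : g ∣ N (n + 1) - N n := by
    have : N (n + 1) - N n = (q - N n) + (N (n + 1) - q) := by omega
    rw [this]
    exact Nat.dvd_add (Nat.gcd_dvd_left _ _) (Nat.gcd_dvd_right _ _)
  have fN : Per w g (N n) := per_mono f h1.le
  have m1 := hs.min hP hgpos (by omega) fN
  have dg : N n - N (n - 1) ∣ g := by
    rcases Nat.eq_or_lt_of_le m1 with e | e
    · rw [e]
    · exact hs.dvd hP hn hgpos fN (by omega)
  have pd : Per w (N n - N (n - 1)) (N n) := pal_per (hs.pal _) (hs.pal _) hlt.le
  have pg : Per w g (N (n + 1)) :=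
    per_ext a3 (by omega) (fun x hx => per_mod f x (by omega)) gD
  refine ⟨per_ext pg hgpos (fun x hx => per_mod pd x (by omega)) dg, dg.trans gD, by omega⟩

theorem exists_prev {S : Set ℕ} (h0 : 0 ∈ S) {n : ℕ} (hn : 1 ≤ n) (hS : n ∈ S) :
    ∃ m, ConsecIn S m n := by
  classical
  have hspec := Nat.findGreatest_spec (P := fun k => k ∈ S) (Nat.zero_le (n - 1)) h0
  have hle := Nat.findGreatest_le (P := fun k => k ∈ S) (n - 1)
  refine ⟨Nat.findGreatest (fun k => k ∈ S) (n - 1), hspec, hS, by omega, ?_⟩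
  rintro k hk ⟨h1, h2⟩
  exact Nat.findGreatest_is_greatest h1 (by omega) hk

theorem Sys.step (hs : Sys ψ w N) (hR : Reduced ψ) {n : ℕ} (hP : P w N n) : P w N (n + 1) := by
  intro q hqle hq
  by_cases hq1 : q ≤ N n
  · exact hP q hq1 hq
  by_cases hq2 : q = N (n + 1)
  · exact ⟨_, hq2⟩
  exfalso
  have h1 : N n < q := by omega
  have h2 : q < N (n + 1) := by omega
  have hle : N (n + 1) ≤ 2 * N n + 1 := by
    cases hψ : ψ n with
    | inl a => have := hs.inl _ _ hψ; omega
    | inr j => have := hs.inr _ _ hψ; omega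
  have hn : 1 ≤ n := by
    by_contra h
    have : n = 0 := by omega
    subst this
    have := hs.zero
    omega
  obtain ⟨b1, b2, b3⟩ := hs.step1 hP hn hq h1 h2 hle
  have hlt : N (n - 1) < N n := hs.mono (by omega)
  have h0S : 0 ∈ Sset ψ := by
    cases hψ : ψ 0 with
    | inl a => exact Or.inl ⟨a, hψ⟩
    | inr j => have := hs.inr _ _ hψ; omega
  have hnS : n ∈ Sset ψ := by
    cases hψ : ψ n with
    | inl a => exact Or.inl ⟨a, hψ⟩
    | inr j =>
      refine Or.inr ⟨j, hψ, ?_⟩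
      have := hs.inr _ _ hψ
      by_contra hj
      have : j = n - 1 := by omega
      subst this
      omega
  obtain ⟨m, hc⟩ := exists_prev h0S hn hnS
  obtain ⟨hne, hred⟩ := hR m n hc
  obtain ⟨-, hdd⟩ := hs.chain_per hc
  have hmn := hc.2.2.1
  have hch := hs.chain hc (n - m) (by omega)
  rw [Nat.add_sub_cancel' hmn.le] at hch
  rw [hdd] at b1 b2 b3
  have hmlt : N m < N (m + 1) := hs.mono (Nat.lt_succ_self m)
  have hm1n : N (m + 1) ≤ N n := hs.mono.monotone hmn
  have hnlt : N n < N (n + 1) := hs.mono (Nat.lt_succ_self n)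
  have hPm : P w N m := fun L hL hpal => hP L (by omega) hpal
  have hPm1 : P w N (m + 1) := fun L hL hpal => hP L (by omega) hpal
  -- the case of a large first block
  have key : 2 * (N (m + 1) - N m) ≤ N m + 1 → False := by
    intro h2d
    have hmS := hc.1
    rcases hmS with ⟨a, ha⟩ | ⟨j, hj, hjm⟩
    · have := hs.inl _ _ ha; omega
    · have hj2 := (hs.inr _ _ hj).2
      have l1 : N j < N (m - 1) := hs.mono (by omega)
      have l2 : N (m - 1) < N m := hs.mono (by omega)
      have pm : Per w (N (m + 1) - N m) (N (m + 1)) :=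
        pal_per (hs.pal _) (hs.pal _) hmlt.le
      have hdv := hs.dvd (n := m) hPm (by omega) (by omega) (per_mono pm hmlt.le) (by omega)
      have p0 : Per w (N m - N (m - 1)) (N m) := pal_per (hs.pal _) (hs.pal _) l2.le
      have p1 : Per w (N m - N (m - 1)) (N (m + 1)) :=
        per_ext pm (by omega) (fun x hx => per_mod p0 x (by omega)) hdv
      have h3 := Nat.dvd_sub hdv (dvd_refl (N m - N (m - 1)))
      obtain ⟨i, hi⟩ := hPm1 _ (Nat.sub_le _ _) (per_pal (hs.pal _) (per_mul p1 h3))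
      exact hs.gap (k := m) (i := i) (by omega) (by omega)
  set d := N (m + 1) - N m with hd
  rcases hred with ⟨a, ha⟩ | ⟨j, hj, hjm⟩
  · obtain ⟨c1, c2⟩ := hs.inl _ _ ha
    have hdv : d ∣ N m + 1 := by
      have e : N (n + 1) - N n = (N m + 1) + (n - m) * d := by omega
      rw [e] at b2
      exact (Nat.dvd_add_left (Dvd.intro_left _ rfl)).1 b2
    obtain ⟨c, hcc⟩ := hdv
    have hc0 : c ≠ 0 := by rintro rfl; simp at hcc
    by_cases hc1 : c = 1
    · subst hc1
      cases hψ : ψ m with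
      | inl b =>
        obtain ⟨_, c4⟩ := hs.inl _ _ hψ
        apply hne
        rw [ha, hψ, ← c2, ← c4]
        congr 1
        rw [per_mod b1 _ hnlt, per_mod b1 (N m) (by omega), hch, Nat.add_mul_mod_self_right]
      | inr j => 
        have := (hs.inr _ _ hψ).2
        omega
    · apply key
      have : 2 ≤ c := by omega
      nlinarith
  · obtain ⟨c1, c2⟩ := hs.inr _ _ hj
    have hjlt : N j < N m := hs.mono hjm
    have hdv : d ∣ N m - N j := by
      have e : N (n + 1) - N n = (N m - N j) + (n - m) * d := by omega
      rw [e] at b2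
      exact (Nat.dvd_add_left (Dvd.intro_left _ rfl)).1 b2
    obtain ⟨c, hcc⟩ := hdv
    have hc0 : c ≠ 0 := by rintro rfl; simp at hcc; omega
    by_cases hc1 : c = 1
    · subst hc1
      cases hψ : ψ m with
      | inl b =>
        have := (hs.inl _ _ hψ).1
        omega
      | inr j' =>
        have := (hs.inr _ _ hψ).2
        apply hne
        rw [hj, hψ]
        congr 1
        exact hs.mono.injective (by omega)
    · apply key
      have : 2 ≤ c := by omega
      have : d * 2 ≤ d * c := Nat.mul_le_mul_left _ this
      omega

theorem Sys.main (hs : Sys ψ w N) : Reduced ψ ↔ ∀ L, Pal w L → ∃ i, L = N i := by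
  refine ⟨fun hR L hL => ?_, hs.backward⟩
  have hall : ∀ n, P w N n := by
    intro n
    induction n with
    | zero =>
      intro L hL _
      exact ⟨0, by have := hs.zero; omega⟩
    | succ n ih => exact hs.step hR ih
  exact hall L L (hs.mono.id_le L) hL

theorem pref_length (w : ℕ → A) (n : ℕ) : (pref w n).length = n := by simp [pref]

theorem pref_get (w : ℕ → A) (n i : ℕ) (h : i < n) : (pref w n)[i]? = some (w i) := by
  simp [pref, h]

theorem pal_iff (w : ℕ → A) (n : ℕ) : (pref w n).Palindrome ↔ Pal w n := by
  rw [List.Palindrome.iff_reverse_eq]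
  constructor
  · intro h i j hij
    have h1 := pref_get w n i (by omega)
    rw [← h, List.getElem?_reverse (by rw [pref_length]; omega), pref_length,
      pref_get _ _ _ (by omega)] at h1
    have h2 : n - 1 - i = j := by omega
    rw [h2] at h1
    exact (Option.some.inj h1).symm
  · intro h
    apply List.ext_getElem?
    intro i
    by_cases hi : i < n
    · rw [List.getElem?_reverse (by rw [pref_length]; omega), pref_length,
        pref_get _ _ _ (by omega), pref_get _ _ _ hi, h _ i (by omega)]
    · rw [List.getElem?_eq_none (by simp [pref]; omega),
        List.getElem?_eq_none (by simp [pref]; omega)]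

theorem sys_of (hadm : Admissible ψ) (hw : ∀ i, pref w (piW ψ i).length = piW ψ i) :
    Sys ψ w (fun i => (piW ψ i).length) := by
  have getw : ∀ i x, x < (piW ψ i).length → (piW ψ i)[x]? = some (w x) := by
    intro i x hx
    rw [← hw i]
    exact pref_get _ _ _ hx
  have hl : ∀ i a, ψ i = Sum.inl a → piW ψ (i + 1) = piW ψ i ++ a :: piW ψ i := by
    intro i a h; simp [piW, h]
  have hr : ∀ i j, ψ i = Sum.inr j →
      piW ψ (i + 1) = piW ψ i ++ (piW ψ i).drop (piW ψ j).length := by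
    intro i j h
    have := hadm i j h
    simp [piW, h, min_eq_left this.le]
  have hstep : ∀ i, (∀ j < i, (piW ψ j).length < (piW ψ i).length) →
      (piW ψ i).length < (piW ψ (i + 1)).length := by
    intro i ih
    cases hψ : ψ i with
    | inl a => rw [hl _ _ hψ]; simp
    | inr j => have := ih j (hadm i j hψ); rw [hr _ _ hψ]; simp; omega
  have hlt : ∀ i, ∀ j < i, (piW ψ j).length < (piW ψ i).length := by
    intro i
    induction i with
    | zero => intro j hj; omega
    | succ i ih =>
      intro j hj
      have := hstep i ih
      rcases Nat.lt_succ_iff_lt_or_eq.1 hj with h | h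
      · exact (ih j h).trans this
      · rw [h]; exact this
  have hinl : ∀ i a, ψ i = Sum.inl a → (piW ψ (i+1)).length = 2 * (piW ψ i).length + 1 ∧
      w (piW ψ i).length = a := by
    intro i a h
    have e := hl i a h
    have hlen : (piW ψ (i+1)).length = 2 * (piW ψ i).length + 1 := by rw [e]; simp; omega
    refine ⟨hlen, ?_⟩
    have := getw (i + 1) (piW ψ i).length (by omega)
    rw [e] at this
    simpa using this.symm
  have hinr : ∀ i j, ψ i = Sum.inr j → j < i ∧
      (piW ψ (i+1)).length + (piW ψ j).length = 2 * (piW ψ i).length := by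
    intro i j h
    have e := hr i j h
    have hj := hadm i j h
    have := hlt i j hj
    refine ⟨hj, ?_⟩
    rw [e]; simp; omega
  refine ⟨by simp [piW], fun a b h => hlt b a h, ?_, hinl, hinr⟩
  intro i
  induction i using Nat.strong_induction_on with
  | _ i ih =>
    cases i with
    | zero => intro a b h; simp [piW] at h
    | succ i =>
      have hi := ih i (by omega)
      cases hψ : ψ i with
      | inl a =>
        have h1 := (hinl _ _ hψ).1
        have e := hl _ _ hψ
        have hp : Per w ((piW ψ i).length + 1) ((piW ψ i).length + ((piW ψ i).length + 1)) := by
          intro x hx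
          have g1 := getw (i + 1) (x + ((piW ψ i).length + 1)) (by omega)
          rw [e, List.getElem?_append_right (by omega)] at g1
          have : x + ((piW ψ i).length + 1) - (piW ψ i).length = x + 1 := by omega
          rw [this, List.getElem?_cons_succ, getw i x (by omega)] at g1
          exact Option.some.inj g1
        have := pal_ext hi hp le_rfl
        have e2 : (piW ψ (i + 1)).length = (piW ψ i).length + ((piW ψ i).length + 1) := by omega
        rw [e2]; exact this
      | inr j =>
        obtain ⟨hj, h1⟩ := hinr _ _ hψ
        have e := hr _ _ hψ
        have hjl := hlt i j hj
        have pp := pal_per (ih j (by omega)) hi hjl.le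
        have e2 : (piW ψ (i + 1)).length =
          (piW ψ i).length + ((piW ψ i).length - (piW ψ j).length) := by omega
        rw [e2]
        refine pal_ext hi ?_ (by omega)
        intro x hx
        by_cases hx' : x + ((piW ψ i).length - (piW ψ j).length) < (piW ψ i).length
        · exact pp x hx'
        · have g1 := getw (i + 1) (x + ((piW ψ i).length - (piW ψ j).length)) (by omega)
          rw [e, List.getElem?_append_right (by omega), List.getElem?_drop] at g1
          have : (piW ψ j).length +
            (x + ((piW ψ i).length - (piW ψ j).length) - (piW ψ i).length) = x := by omega
          rw [this, getw i x (by omega)] at g1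
          exact Option.some.inj g1

end PalAux

theorem stmt10 {A : Type*} (ψ : ℕ → A ⊕ ℕ) (hadm : Admissible ψ)
    (w : ℕ → A) (hw : ∀ i, pref w (piW ψ i).length = piW ψ i) :
    Reduced ψ ↔
      ∀ u : List A, (u.Palindrome ∧ pref w u.length = u) ↔ ∃ i, u = piW ψ i := by
  have hs := PalAux.sys_of hadm hw
  rw [hs.main]
  constructor
  · intro h u
    constructor
    · rintro ⟨hp, hu⟩
      rw [← hu, PalAux.pal_iff] at hp
      obtain ⟨i, hi⟩ := h _ hp
      refine ⟨i, ?_⟩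
      rw [← hu, hi, hw]
    · rintro ⟨i, rfl⟩
      refine ⟨?_, hw i⟩
      rw [← hw i, PalAux.pal_iff]
      exact hs.pal i
  · intro h L hL
    obtain ⟨i, hi⟩ := (h (pref w L)).1
      ⟨(PalAux.pal_iff w L).2 hL, by rw [PalAux.pref_length]⟩
    exact ⟨i, by simp only [← hi, PalAux.pref_length]⟩
end
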